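/- Upper bound on the one-step decrease of the HC-MPC value function: Fix integers N ≥ 3 and 2 ≤ Ñ ≤ N−1, and let x ∈ X₁. Let u* be an HC-admissible sequence attaining V_N^Ñ(x), and set y = f(x, u*(0)). Let w* be an HC-admissible sequence attaining V_N^Ñ(y) with trajectory z*(·) (z*(0) = y), and set x_p = z*(N−Ñ). If the minima V_Ñ^Ñ(x_p) and V_{Ñ−1}(x_p) are attained, then V_N^Ñ(x) − V_N^Ñ(y) ≤ l(x, u*(0)) − ( V_Ñ^Ñ(x_p) − V_{Ñ−1}(x_p) ). -/

import Mathlib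

/-!
Setting for heterogeneously constrained MPC (HC-MPC) and uniformly constrained
MPC (UC-MPC).  `f : ℝⁿ × ℝᵐ → ℝⁿ` is the discrete-time system map, `U ⊆ ℝᵐ`
the input-constraint set, `X₁ ⊆ X₂ ⊆ ℝⁿ` the state-constraint sets, and
`l : ℝⁿ × ℝᵐ → ℝ` the (nonnegative) stage cost.
-/

/-- The open-loop trajectory generated from initial state `x` by the input
sequence `u`: `x(0) = x`, `x(k+1) = f(x(k), u(k))`. -/
def Traj {n m : ℕ} (f : (Fin n → ℝ) → (Fin m → ℝ) → (Fin n → ℝ))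
    (x : Fin n → ℝ) (u : ℕ → (Fin m → ℝ)) : ℕ → (Fin n → ℝ)
  | 0 => x
  | k + 1 => f (Traj f x u k) (u k)

/-- The `N`-stage open-loop cost `Σ_{k=0}^{N-1} l(x(k), u(k))`. -/
def Cost {n m : ℕ} (f : (Fin n → ℝ) → (Fin m → ℝ) → (Fin n → ℝ))
    (l : (Fin n → ℝ) → (Fin m → ℝ) → ℝ)
    (x : Fin n → ℝ) (u : ℕ → (Fin m → ℝ)) (N : ℕ) : ℝ :=
  ∑ k ∈ Finset.range N, l (Traj f x u k) (u k)

/-- HC-admissibility at `x` with prediction horizon `N` and constraint horizon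
`Nt` (written `Ñ` in the paper): inputs lie in `U`, the predicted states
`x(n+1)` lie in `X₁` for `n = 0,…,N−Ñ` and in `X₂` for `n = N−Ñ+1,…,N−1`. -/
def HCAdm {n m : ℕ} (f : (Fin n → ℝ) → (Fin m → ℝ) → (Fin n → ℝ))
    (U : Set (Fin m → ℝ)) (X₁ X₂ : Set (Fin n → ℝ))
    (N Nt : ℕ) (x : Fin n → ℝ) (u : ℕ → (Fin m → ℝ)) : Prop :=
  (∀ k, k < N → u k ∈ U) ∧
  (∀ k, k ≤ N - Nt → Traj f x u (k + 1) ∈ X₁) ∧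
  (∀ k, N - Nt + 1 ≤ k → k ≤ N - 1 → Traj f x u (k + 1) ∈ X₂)

/-- UC-admissibility at `x` with horizon `N`: inputs lie in `U` and all
predicted states `x(n+1)`, `n = 0,…,N−1`, lie in `X₂`. -/
def UCAdm {n m : ℕ} (f : (Fin n → ℝ) → (Fin m → ℝ) → (Fin n → ℝ))
    (U : Set (Fin m → ℝ)) (X₂ : Set (Fin n → ℝ))
    (N : ℕ) (x : Fin n → ℝ) (u : ℕ → (Fin m → ℝ)) : Prop :=
  (∀ k, k < N → u k ∈ U) ∧
  (∀ k, k < N → Traj f x u (k + 1) ∈ X₂)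

/-- `V` is the attained minimum `V_N^Ñ(x)` of the HC-MPC problem: some
HC-admissible sequence realizes cost `V`, and `V` is a lower bound on the cost
of every HC-admissible sequence. -/
def IsHCValue {n m : ℕ} (f : (Fin n → ℝ) → (Fin m → ℝ) → (Fin n → ℝ))
    (U : Set (Fin m → ℝ)) (X₁ X₂ : Set (Fin n → ℝ))
    (l : (Fin n → ℝ) → (Fin m → ℝ) → ℝ)
    (N Nt : ℕ) (x : Fin n → ℝ) (V : ℝ) : Prop :=
  (∃ u, HCAdm f U X₁ X₂ N Nt x u ∧ Cost f l x u N = V) ∧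
  (∀ u, HCAdm f U X₁ X₂ N Nt x u → V ≤ Cost f l x u N)

/-- `V` is the attained minimum `V_N(x)` of the UC-MPC problem. -/
def IsUCValue {n m : ℕ} (f : (Fin n → ℝ) → (Fin m → ℝ) → (Fin n → ℝ))
    (U : Set (Fin m → ℝ)) (X₂ : Set (Fin n → ℝ))
    (l : (Fin n → ℝ) → (Fin m → ℝ) → ℝ)
    (N : ℕ) (x : Fin n → ℝ) (V : ℝ) : Prop :=
  (∃ u, UCAdm f U X₂ N x u ∧ Cost f l x u N = V) ∧
  (∀ u, UCAdm f U X₂ N x u → V ≤ Cost f l x u N)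

section Splicing

variable {n m : ℕ} (f : (Fin n → ℝ) → (Fin m → ℝ) → (Fin n → ℝ))
  (l : (Fin n → ℝ) → (Fin m → ℝ) → ℝ)

theorem Traj.congr_input (x : Fin n → ℝ) {u v : ℕ → (Fin m → ℝ)} {k : ℕ}
    (h : ∀ j < k, u j = v j) : Traj f x u k = Traj f x v k := by
  induction k with
  | zero => rfl
  | succ k ih =>
    rw [Traj, Traj, ih fun j hj => h j (by omega), h k (by omega)]

theorem Traj.add (x : Fin n → ℝ) (u : ℕ → (Fin m → ℝ)) (M k : ℕ) :
    Traj f x u (M + k) = Traj f (Traj f x u M) (fun j => u (M + j)) k := by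
  induction k with
  | zero => rfl
  | succ k ih => rw [← add_assoc, Traj, Traj, ih]

theorem Cost.congr_input (x : Fin n → ℝ) {u v : ℕ → (Fin m → ℝ)} {N : ℕ}
    (h : ∀ j < N, u j = v j) : Cost f l x u N = Cost f l x v N := by
  refine Finset.sum_congr rfl fun k hk => ?_
  have hk := Finset.mem_range.mp hk
  rw [Traj.congr_input f x fun j hj => h j (hj.trans hk), h k hk]

theorem Cost.add (x : Fin n → ℝ) (u : ℕ → (Fin m → ℝ)) (M k : ℕ) :
    Cost f l x u (M + k) =
      Cost f l x u M + Cost f l (Traj f x u M) (fun j => u (M + j)) k := by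
  simp only [Cost, Finset.sum_range_add, Traj.add]

/-- The input sequence that applies the first `M` inputs of `u`, then `v`. -/
def splice (u : ℕ → (Fin m → ℝ)) (M : ℕ) (v : ℕ → (Fin m → ℝ)) : ℕ → (Fin m → ℝ) :=
  fun k => if k < M then u k else v (k - M)

theorem splice_of_lt (u v : ℕ → (Fin m → ℝ)) {M k : ℕ} (h : k < M) :
    splice u M v k = u k := if_pos h

theorem splice_add (u v : ℕ → (Fin m → ℝ)) (M k : ℕ) :
    splice u M v (M + k) = v k := by
  simp [splice]

theorem Traj.splice_of_le (x : Fin n → ℝ) (u v : ℕ → (Fin m → ℝ)) {M k : ℕ} (h : k ≤ M) :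
    Traj f x (splice u M v) k = Traj f x u k :=
  Traj.congr_input f x fun _ hj => splice_of_lt u v (hj.trans_le h)

theorem Traj.splice_add (x : Fin n → ℝ) (u v : ℕ → (Fin m → ℝ)) (M k : ℕ) :
    Traj f x (splice u M v) (M + k) = Traj f (Traj f x u M) v k := by
  simp only [Traj.add f x (splice u M v), Traj.splice_of_le f x u v le_rfl, _root_.splice_add]

theorem Cost.splice_add (x : Fin n → ℝ) (u v : ℕ → (Fin m → ℝ)) (M k : ℕ) :
    Cost f l x (splice u M v) (M + k) = Cost f l x u M + Cost f l (Traj f x u M) v k := by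
  simp only [Cost.add f l x (splice u M v), Traj.splice_of_le f x u v le_rfl, _root_.splice_add,
    Cost.congr_input f l x fun _ hj => splice_of_lt u v hj]

end Splicing

section Admissibility

variable {n m : ℕ} {f : (Fin n → ℝ) → (Fin m → ℝ) → (Fin n → ℝ)}
  {U : Set (Fin m → ℝ)} {X₁ X₂ : Set (Fin n → ℝ)}

theorem HCAdm.tail {N Nt : ℕ} (hNt : 1 ≤ Nt) (hN : Nt ≤ N) {y : Fin n → ℝ}
    {w : ℕ → (Fin m → ℝ)} (h : HCAdm f U X₁ X₂ N Nt y w) :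
    HCAdm f U X₁ X₂ Nt Nt (Traj f y w (N - Nt)) (fun j => w (N - Nt + j)) := by
  obtain ⟨hU, h₁, h₂⟩ := h
  refine ⟨fun k hk => hU _ (by omega), fun k hk => ?_, fun k hk hk' => ?_⟩
  · rw [← Traj.add]
    exact h₁ (N - Nt + k) (by omega)
  · rw [← Traj.add]
    exact h₂ (N - Nt + k) (by omega) (by omega)

/-- Prepending `u 0` to the `X₁`-constrained part of `w`, and continuing with a UC-admissible
sequence of length `Nt - 1`, gives an HC-admissible sequence. -/
theorem HCAdm.splice {N Nt : ℕ} (hNt : 1 ≤ Nt) (hN : Nt ≤ N) {x : Fin n → ℝ}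
    {u w v : ℕ → (Fin m → ℝ)} (hu : u 0 ∈ U) (hy : f x (u 0) ∈ X₁)
    (hw : HCAdm f U X₁ X₂ N Nt (f x (u 0)) w)
    (hv : UCAdm f U X₂ (Nt - 1) (Traj f (f x (u 0)) w (N - Nt)) v) :
    HCAdm f U X₁ X₂ N Nt x (splice u 1 (splice w (N - Nt) v)) := by
  obtain ⟨hwU, hw₁, -⟩ := hw
  obtain ⟨hvU, hv₂⟩ := hv
  refine ⟨fun k hk => ?_, fun k hk => ?_, fun k hk hk' => ?_⟩
  · rcases Nat.eq_zero_or_pos k with rfl | hk0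
    · rwa [splice_of_lt _ _ one_pos]
    obtain ⟨j, rfl⟩ := Nat.exists_eq_add_of_le hk0
    rw [splice_add]
    rcases lt_or_ge j (N - Nt) with hj | hj
    · rw [splice_of_lt _ _ hj]
      exact hwU j (by omega)
    · obtain ⟨i, rfl⟩ := Nat.exists_eq_add_of_le hj
      rw [splice_add]
      exact hvU i (by omega)
  · rw [add_comm k 1, Traj.splice_add, Traj.splice_of_le _ _ _ _ hk]
    cases k with
    | zero => exact hy
    | succ k => exact hw₁ k (by omega)
  · obtain ⟨i, rfl⟩ := Nat.exists_eq_add_of_le hk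
    rw [show N - Nt + 1 + i + 1 = 1 + (N - Nt + (i + 1)) by omega, Traj.splice_add,
      Traj.splice_add]
    exact hv₂ i (by omega)

end Admissibility

/-- **Upper bound on the one-step decrease of the HC-MPC value function (Lemma 6).**
With `y = f(x, u*(0))` the closed-loop successor, `w*` an optimal sequence for
`V_N^Ñ(y)` and `x_p = z*(N−Ñ)`, one has
`V_N^Ñ(x) − V_N^Ñ(y) ≤ l(x, u*(0)) − (V_Ñ^Ñ(x_p) − V_{Ñ−1}(x_p))`. -/
theorem one_step_decrease_upper_bound {n m : ℕ}
    (f : (Fin n → ℝ) → (Fin m → ℝ) → (Fin n → ℝ))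
    (U : Set (Fin m → ℝ)) (X₁ X₂ : Set (Fin n → ℝ))
    (l : (Fin n → ℝ) → (Fin m → ℝ) → ℝ)
    (hl : ∀ x u, 0 ≤ l x u) (hX : X₁ ⊆ X₂)
    (N Nt : ℕ) (hN : 3 ≤ N) (hNt₁ : 2 ≤ Nt) (hNt₂ : Nt ≤ N - 1)
    (x : Fin n → ℝ) (hx : x ∈ X₁)
    -- optimal sequence attaining `V_N^Ñ(x)`
    (u : ℕ → (Fin m → ℝ)) (V : ℝ)
    (hadm : HCAdm f U X₁ X₂ N Nt x u)
    (hcost : Cost f l x u N = V)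
    (hmin : ∀ u', HCAdm f U X₁ X₂ N Nt x u' → V ≤ Cost f l x u' N)
    -- optimal sequence attaining `V_N^Ñ(y)` at `y = f(x, u*(0))`
    (w : ℕ → (Fin m → ℝ)) (Vy : ℝ)
    (hadmw : HCAdm f U X₁ X₂ N Nt (f x (u 0)) w)
    (hcostw : Cost f l (f x (u 0)) w N = Vy)
    (hminw : ∀ u', HCAdm f U X₁ X₂ N Nt (f x (u 0)) u' → Vy ≤ Cost f l (f x (u 0)) u' N)
    -- attained minima at `x_p = z*(N−Ñ)`
    (A B : ℝ)
    (hA : IsHCValue f U X₁ X₂ l Nt Nt (Traj f (f x (u 0)) w (N - Nt)) A)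
    (hB : IsUCValue f U X₂ l (Nt - 1) (Traj f (f x (u 0)) w (N - Nt)) B) :
    V - Vy ≤ l x (u 0) - (A - B) := by
  obtain ⟨⟨v, hv, rfl⟩, -⟩ := hB
  have hV := hmin _ (HCAdm.splice (by omega) (by omega) (hadm.1 0 (by omega))
    (hadm.2.1 0 (Nat.zero_le _)) hadmw hv)
  have hA' := hA.2 _ (hadmw.tail (by omega) (by omega))
  have hVy := Cost.add f l (f x (u 0)) w (N - Nt) Nt
  rw [Nat.sub_add_cancel (by omega), hcostw] at hVy
  have hsplit : N = 1 + (N - Nt + (Nt - 1)) := by omega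
  have hCost : Cost f l x (splice u 1 (splice w (N - Nt) v)) N =
      l x (u 0) + (Cost f l (f x (u 0)) w (N - Nt) +
        Cost f l (Traj f (f x (u 0)) w (N - Nt)) v (Nt - 1)) := by
    have h₁ := Cost.splice_add f l x u (splice w (N - Nt) v) 1 (N - Nt + (Nt - 1))
    rw [← hsplit, Cost.splice_add] at h₁
    rw [h₁]
    simp [Traj, show Cost f l x u 1 = l x (u 0) by simp [Cost, Traj]]
  linarith
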